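/- Let E be a row-finite directed graph and K any field. Then L_K(E) satisfies the ascending chain condition on two-sided ideals if and only if the partially ordered set (under inclusion) of hereditary saturated subsets of E^0 satisfies the ascending chain condition. In particular, for every finite graph E, L_K(E) satisfies the ascending chain condition on two-sided ideals. -/

import Mathlib

set_option synthInstance.maxHeartbeats 1000000
set_option maxHeartbeats 1000000

/-- Generators of the Leavitt path algebra: vertices, edges, and ghost edges. -/
inductive LPAGen (V E : Type) : Type
  | vertex : V → LPAGen V E
  | edge : E → LPAGen V E
  | ghost : E → LPAGen V E

/-- The defining relations of the Leavitt path algebra of the graph with vertex set `V`,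
edge set `E`, and source and range maps `s r : E → V`.  The (CK2) relation is imposed at
every regular vertex, i.e. every vertex emitting finitely many but at least one edge. -/
inductive LPARel (K : Type) [Field K] {V E : Type} (s r : E → V) :
    FreeAlgebra K (LPAGen V E) → FreeAlgebra K (LPAGen V E) → Prop
  | vertex_self (v : V) :
      LPARel K s r (FreeAlgebra.ι K (LPAGen.vertex v) * FreeAlgebra.ι K (LPAGen.vertex v))
        (FreeAlgebra.ι K (LPAGen.vertex v))
  | vertex_ne {v w : V} (h : v ≠ w) :
      LPARel K s r (FreeAlgebra.ι K (LPAGen.vertex v) * FreeAlgebra.ι K (LPAGen.vertex w)) 0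
  | edge_left (e : E) :
      LPARel K s r (FreeAlgebra.ι K (LPAGen.vertex (s e)) * FreeAlgebra.ι K (LPAGen.edge e))
        (FreeAlgebra.ι K (LPAGen.edge e))
  | edge_right (e : E) :
      LPARel K s r (FreeAlgebra.ι K (LPAGen.edge e) * FreeAlgebra.ι K (LPAGen.vertex (r e)))
        (FreeAlgebra.ι K (LPAGen.edge e))
  | ghost_left (e : E) :
      LPARel K s r (FreeAlgebra.ι K (LPAGen.vertex (r e)) * FreeAlgebra.ι K (LPAGen.ghost e))
        (FreeAlgebra.ι K (LPAGen.ghost e))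
  | ghost_right (e : E) :
      LPARel K s r (FreeAlgebra.ι K (LPAGen.ghost e) * FreeAlgebra.ι K (LPAGen.vertex (s e)))
        (FreeAlgebra.ι K (LPAGen.ghost e))
  | ck1_self (e : E) :
      LPARel K s r (FreeAlgebra.ι K (LPAGen.ghost e) * FreeAlgebra.ι K (LPAGen.edge e))
        (FreeAlgebra.ι K (LPAGen.vertex (r e)))
  | ck1_ne {e f : E} (h : e ≠ f) :
      LPARel K s r (FreeAlgebra.ι K (LPAGen.ghost e) * FreeAlgebra.ι K (LPAGen.edge f)) 0
  | ck2 (v : V) (h : {e : E | s e = v}.Finite) (hne : {e : E | s e = v}.Nonempty) :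
      LPARel K s r (FreeAlgebra.ι K (LPAGen.vertex v))
        (h.toFinset.sum fun e => FreeAlgebra.ι K (LPAGen.edge e) * FreeAlgebra.ι K (LPAGen.ghost e))

/-- The unital algebra presented by the Leavitt path algebra generators and relations
(for a graph with possibly infinitely many vertices this is the unitalization of the
Leavitt path algebra; the honest Leavitt path algebra is the non-unital subalgebra `lpa`
generated by the generators, defined below). -/
abbrev LPAU (K : Type) [Field K] {V E : Type} (s r : E → V) : Type :=
  RingQuot (LPARel K s r)

variable (K : Type) [Field K] {V E : Type} (s r : E → V)

/-- The canonical image of a generator. -/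
def gen (g : LPAGen V E) : LPAU K s r :=
  RingQuot.mkAlgHom K (LPARel K s r) (FreeAlgebra.ι K g)

def vertexEl (v : V) : LPAU K s r := gen K s r (LPAGen.vertex v)
def edgeEl (e : E) : LPAU K s r := gen K s r (LPAGen.edge e)
def ghostEl (e : E) : LPAU K s r := gen K s r (LPAGen.ghost e)

/-- The Leavitt path algebra `L_K(E)` of an arbitrary graph, realized (honestly, i.e.
without an adjoined unit) as the non-unital subalgebra generated by the vertices, edges
and ghost edges. -/
def lpa : NonUnitalSubalgebra K (LPAU K s r) :=
  NonUnitalAlgebra.adjoin K (Set.range (gen K s r))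

def vertexIn (v : V) : ↥(lpa K s r) :=
  ⟨vertexEl K s r v, NonUnitalAlgebra.subset_adjoin K (Set.mem_range_self _)⟩

def edgeIn (e : E) : ↥(lpa K s r) :=
  ⟨edgeEl K s r e, NonUnitalAlgebra.subset_adjoin K (Set.mem_range_self _)⟩

def ghostIn (e : E) : ↥(lpa K s r) :=
  ⟨ghostEl K s r e, NonUnitalAlgebra.subset_adjoin K (Set.mem_range_self _)⟩

instance lpaNonUnitalRing : NonUnitalRing ↥(lpa K s r) := inferInstance
instance lpaAddCommGroup : AddCommGroup ↥(lpa K s r) := inferInstance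
instance lpaModule : Module K ↥(lpa K s r) := inferInstance

/-- Paths in a directed graph: `IsPathFrom s r v w es` means the list of edges `es` is a
directed path from `v` to `w` (each vertex is a path of length `0`). -/
inductive IsPathFrom {V E : Type} (s r : E → V) : V → V → List E → Prop
  | nil (v : V) : IsPathFrom s r v v []
  | cons (e : E) {w : V} {es : List E} :
      IsPathFrom s r (r e) w es → IsPathFrom s r (s e) w (e :: es)

/-- `v ≥ w` : there is a path from `v` to `w`. -/
def Geq {V E : Type} (s r : E → V) (v w : V) : Prop :=
  ∃ es : List E, IsPathFrom s r v w es

/-- A cycle based at `v` : a nonempty closed path whose source vertices are pairwise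
distinct. -/
def IsCycle {V E : Type} (s r : E → V) (v : V) (es : List E) : Prop :=
  es ≠ [] ∧ IsPathFrom s r v v es ∧ (es.map s).Nodup

/-- A path (given by its list of edges) has an exit. -/
def HasExit {V E : Type} (s : E → V) (es : List E) : Prop :=
  ∃ f : E, ∃ e ∈ es, s f = s e ∧ f ≠ e

/-- A set of vertices is hereditary. -/
def Hereditary {V E : Type} (s r : E → V) (X : Set V) : Prop :=
  ∀ v ∈ X, ∀ w : V, Geq s r v w → w ∈ X

/-- A set of vertices is saturated. -/
def Saturated {V E : Type} (s r : E → V) (X : Set V) : Prop :=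
  ∀ v : V, {e : E | s e = v}.Finite → {e : E | s e = v}.Nonempty →
    (∀ e : E, s e = v → r e ∈ X) → v ∈ X

/-- A subset of a (possibly non-unital) ring is a two-sided ideal. -/
def IsTwoSidedIdealSet {R : Type} [Zero R] [Add R] [Neg R] [Mul R] (I : Set R) : Prop :=
  (0 : R) ∈ I ∧ (∀ a ∈ I, ∀ b ∈ I, a + b ∈ I) ∧ (∀ a ∈ I, -a ∈ I) ∧
    ∀ x : R, ∀ a ∈ I, x * a ∈ I ∧ a * x ∈ I


section Graph

variable {s r}

theorem isPathFrom_nil_iff {v w : V} : IsPathFrom s r v w [] ↔ v = w :=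
  ⟨fun h => by cases h; rfl, fun h => h ▸ .nil v⟩

theorem isPathFrom_cons_iff {v w : V} {e : E} {es : List E} :
    IsPathFrom s r v w (e :: es) ↔ s e = v ∧ IsPathFrom s r (r e) w es :=
  ⟨fun h => by cases h with | cons _ h => exact ⟨rfl, h⟩, fun h => h.1 ▸ .cons e h.2⟩

theorem isPathFrom_append_iff {v w : V} {p q : List E} :
    IsPathFrom s r v w (p ++ q) ↔ ∃ u, IsPathFrom s r v u p ∧ IsPathFrom s r u w q := by
  induction p generalizing v with
  | nil => simp [isPathFrom_nil_iff]
  | cons e p ih => simp [isPathFrom_cons_iff, ih, and_assoc]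

theorem IsPathFrom.flatten_replicate {v : V} {c : List E} (hc : IsPathFrom s r v v c) (m : ℕ) :
    IsPathFrom s r v v (List.replicate m c).flatten := by
  induction m with
  | zero => exact .nil v
  | succ m ih =>
    rw [List.replicate_succ, List.flatten_cons]
    exact isPathFrom_append_iff.2 ⟨v, hc, ih⟩

theorem Geq.trans {u v w : V} (h₁ : Geq s r u v) (h₂ : Geq s r v w) : Geq s r u w := by
  obtain ⟨p, hp⟩ := h₁
  obtain ⟨q, hq⟩ := h₂
  exact ⟨p ++ q, isPathFrom_append_iff.2 ⟨v, hp, hq⟩⟩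

theorem Geq.refl (v : V) : Geq s r v v := ⟨[], .nil v⟩

theorem Geq.of_edge (e : E) : Geq s r (s e) (r e) := ⟨[e], .cons e (.nil _)⟩

/-- A path that follows a closed path `c` several times and then leaves it is not a prefix of
itself preceded by a short closed path `α`. -/
theorem not_prefix_append_of_exit {pre post α : List E} {e f : E} (hef : f ≠ e) (hα : α ≠ [])
    {m : ℕ} (hm : α.length ≤ m) :
    ¬ (List.replicate m (pre ++ e :: post)).flatten ++ (pre ++ [f]) <+:
      α ++ ((List.replicate m (pre ++ e :: post)).flatten ++ (pre ++ [f])) := by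
  intro h
  set c := pre ++ e :: post with hc
  set γ := (List.replicate m c).flatten ++ (pre ++ [f]) with hγ
  have hpow : ∀ j : ℕ, γ <+: (List.replicate j α).flatten ++ γ := by
    intro j
    induction j with
    | zero => simp
    | succ j ih =>
      rw [List.replicate_succ, List.flatten_cons, List.append_assoc]
      exact h.trans ((List.prefix_append_right_inj α).2 ih)
  obtain ⟨d, rfl⟩ := Nat.exists_eq_add_of_le hm
  obtain ⟨z, hz⟩ := hpow c.length
  have hz' : (List.replicate α.length c).flatten ++
      ((List.replicate d c).flatten ++ (pre ++ [f]) ++ z) =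
      (List.replicate c.length α).flatten ++ γ := by
    rw [← hz, hγ, List.replicate_add, List.flatten_append]
    simp only [List.append_assoc]
  have h2 := (List.append_inj hz' (by simp [mul_comm])).2
  rw [hγ, add_comm, List.replicate_add, List.flatten_append] at h2
  simp only [List.append_assoc] at h2
  have h3 := List.append_cancel_left h2
  obtain ⟨t, ht⟩ : ∃ t, α.length = t + 1 :=
    Nat.exists_eq_succ_of_ne_zero (by simpa using hα)
  rw [ht, List.replicate_succ, List.flatten_cons, hc] at h3
  simp only [List.append_assoc] at h3
  have h4 := List.append_cancel_left h3
  simp at h4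
  exact hef h4.1

variable (s r) in
/-- The vertices outside `H` that lie on a closed path which, outside `H`, has no exit. -/
def exitlessVertices (H : Set V) : Set V :=
  {w | w ∉ H ∧ (∃ es, es ≠ [] ∧ IsPathFrom s r w w es) ∧
    ∀ es, IsPathFrom s r w w es → ∀ e ∈ es, ∀ f, s f = s e → r f ∉ H → f = e}

theorem exists_append_of_exitless {H : Set V} (hH : Hereditary s r H) {u w x : V} {c α : List E}
    (hx : x ∉ H) (hc : IsPathFrom s r u w c) (hα : IsPathFrom s r u x α)
    (hlen : c.length ≤ α.length) (hex : ∀ e ∈ c, ∀ f, s f = s e → r f ∉ H → f = e) :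
    ∃ δ, α = c ++ δ ∧ IsPathFrom s r w x δ := by
  induction c generalizing u α with
  | nil =>
    obtain rfl := isPathFrom_nil_iff.1 hc
    exact ⟨α, rfl, hα⟩
  | cons e c ih =>
    cases α with
    | nil => simp at hlen
    | cons f α =>
      rw [isPathFrom_cons_iff] at hc hα
      have hf : r f ∉ H := fun h => hx (hH _ h _ ⟨α, hα.2⟩)
      obtain rfl := hex e (by simp) f (hα.1.trans hc.1.symm) hf
      obtain ⟨δ, rfl, hδ⟩ := ih hc.2 hα.2 (by simpa using hlen)
        fun e he => hex e (List.mem_cons_of_mem _ he)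
      exact ⟨δ, rfl, hδ⟩

theorem finite_reachable_of_exitless {H : Set V} (hH : Hereditary s r H) {w : V}
    (hw : w ∈ exitlessVertices s r H) : {x | x ∉ H ∧ Geq s r w x}.Finite := by
  obtain ⟨-, ⟨c, hc0, hc⟩, hex⟩ := hw
  refine Set.Finite.subset (c.map s).finite_toSet ?_
  have key : ∀ (es : List E) (u x : V), IsPathFrom s r u x es → x ∉ H → u ∈ c.map s →
      x ∈ c.map s := by
    intro es
    induction es with
    | nil =>
      intro u x h _ hu
      exact isPathFrom_nil_iff.1 h ▸ hu
    | cons f es ih =>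
      intro u x h hx hu
      rw [isPathFrom_cons_iff] at h
      refine ih (r f) x h.2 hx ?_
      obtain ⟨e, he, rfl⟩ := List.mem_map.1 hu
      obtain rfl := hex c hc e he f h.1 fun h' => hx (hH _ h' _ ⟨es, h.2⟩)
      obtain ⟨p, q, rfl⟩ := List.append_of_mem he
      obtain ⟨y, -, hq⟩ := isPathFrom_append_iff.1 hc
      rw [isPathFrom_cons_iff] at hq
      cases q with
      | nil =>
        rw [isPathFrom_nil_iff.1 hq.2]
        cases p with
        | nil => simp [(isPathFrom_cons_iff.1 hc).1]
        | cons d p => simp [(isPathFrom_cons_iff.1 hc).1]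
      | cons d q => simp [← (isPathFrom_cons_iff.1 hq.2).1]
  rintro x ⟨hx, es, hes⟩
  refine key es w x hes hx ?_
  cases c with
  | nil => exact absurd rfl hc0
  | cons d c => simp [(isPathFrom_cons_iff.1 hc).1]

theorem finite_exitlessVertices {H : Set V} (hH : Hereditary s r H)
    (hacc : ∀ g : ℕ → Set V, (∀ n, Hereditary s r (g n) ∧ Saturated s r (g n)) → Monotone g →
      ∃ n, ∀ m, n ≤ m → g m = g n) : (exitlessVertices s r H).Finite := by
  by_contra hinf
  set P := exitlessVertices s r H with hP
  let p := Set.Infinite.natEmbedding P hinf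
  let S : ℕ → Set V := fun n => {q | q ∈ P ∧ ∃ i < n, Geq s r (p i) q}
  have hSfin : ∀ n, (S n).Finite := by
    intro n
    refine Set.Finite.subset (Set.Finite.biUnion (Set.finite_lt_nat n)
      fun i _ => finite_reachable_of_exitless hH (p i).2) ?_
    rintro q ⟨hq, i, hi, hiq⟩
    exact Set.mem_biUnion (Set.mem_ofPred.2 hi) ⟨hq.1, hiq⟩
  obtain ⟨N, hN⟩ := hacc (fun n => {u | ∀ q ∈ P, q ∉ S n → ¬ Geq s r u q}) (by
    refine fun n => ⟨fun v hv w hvw q hq hqS hwq => hv q hq hqS (hvw.trans hwq), ?_⟩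
    rintro v - - hv q hq hqS ⟨es, hes⟩
    cases es with
    | nil =>
      obtain rfl := isPathFrom_nil_iff.1 hes
      obtain ⟨c, hc0, hc⟩ := hq.2.1
      cases c with
      | nil => exact hc0 rfl
      | cons e c =>
        rw [isPathFrom_cons_iff] at hc
        exact hv e hc.1 v hq hqS ⟨c, hc.2⟩
    | cons e es =>
      rw [isPathFrom_cons_iff] at hes
      exact hv e hes.1 q hq hqS ⟨es, hes.2⟩) (by
    intro n m hnm u hu q hq hqS
    exact hu q hq fun h => hqS ⟨h.1, h.2.imp fun i hi => ⟨hi.1.trans_le hnm, hi.2⟩⟩)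
  have hmem : ∀ i, (p i : V) ∈ S N := by
    intro i
    by_contra hi
    have h1 : (p i : V) ∈ {u | ∀ q ∈ P, q ∉ S (max N (i + 1)) → ¬ Geq s r u q} :=
      fun q hq hqS hiq => hqS ⟨hq, i, by omega, hiq⟩
    have h2 := hN (max N (i + 1)) (le_max_left _ _)
    rw [h2] at h1
    exact h1 _ (p i).2 hi (Geq.refl _)
  have := (hSfin N).to_subtype
  exact not_injective_infinite_finite (fun i => (⟨p i, hmem i⟩ : S N))
    fun i j hij => p.injective (Subtype.ext (congrArg Subtype.val hij :))

end Graph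

section Family

/-- A family of elements of a unital algebra `A` that satisfies the Leavitt path algebra relations
and generates `A` as a unital algebra. -/
structure LeavittFamily (A : Type) [Ring A] [Algebra K A] where
  vert : V → A
  edge : E → A
  ghost : E → A
  vert_mul_self : ∀ v, vert v * vert v = vert v
  vert_mul_ne : ∀ v w, v ≠ w → vert v * vert w = 0
  vert_mul_edge : ∀ e, vert (s e) * edge e = edge e
  edge_mul_vert : ∀ e, edge e * vert (r e) = edge e
  vert_mul_ghost : ∀ e, vert (r e) * ghost e = ghost e
  ghost_mul_vert : ∀ e, ghost e * vert (s e) = ghost e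
  ghost_mul_self : ∀ e, ghost e * edge e = vert (r e)
  ghost_mul_ne : ∀ e f, e ≠ f → ghost e * edge f = 0
  vert_eq_sum : ∀ v (h : {e | s e = v}.Finite), {e | s e = v}.Nonempty →
    vert v = ∑ e ∈ h.toFinset, edge e * ghost e
  induction : ∀ p : A → Prop, (∀ k, p (algebraMap K A k)) → (∀ v, p (vert v)) →
    (∀ e, p (edge e)) → (∀ e, p (ghost e)) → (∀ a b, p a → p b → p (a + b)) →
    (∀ a b, p a → p b → p (a * b)) → ∀ a, p a

theorem TwoSidedIdeal.smul_mem_of_algebra {k A : Type} [Field k] [Ring A] [Algebra k A]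
    (J : TwoSidedIdeal A) (c : k) {x : A} (hx : x ∈ J) : c • x ∈ J := by
  rw [Algebra.smul_def]
  exact J.mul_mem_left _ _ hx

theorem TwoSidedIdeal.mem_of_smul_mem {k A : Type} [Field k] [Ring A] [Algebra k A]
    (J : TwoSidedIdeal A) {c : k} (hc : c ≠ 0) {x : A} (hx : c • x ∈ J) : x ∈ J := by
  simpa [smul_smul, hc] using J.smul_mem_of_algebra c⁻¹ hx

theorem Submodule.mul_mem_span_of_forall {k A : Type} [Field k] [Ring A] [Algebra k A] {a b : A}
    {X Y : Set A} (h : ∀ x ∈ X, a * x * b ∈ Submodule.span k Y) {x : A}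
    (hx : x ∈ Submodule.span k X) : a * x * b ∈ Submodule.span k Y := by
  induction hx using Submodule.span_induction with
  | mem x hx => exact h x hx
  | zero => simp
  | add x y _ _ hx hy => rw [mul_add, add_mul]; exact add_mem hx hy
  | smul c x _ hx =>
    rw [mul_smul_comm, smul_mul_assoc]
    exact Submodule.smul_mem _ c hx

theorem Submodule.mul_left_mem_span_of_forall {k A : Type} [Field k] [Ring A] [Algebra k A] {a : A}
    {X Y : Set A} (h : ∀ x ∈ X, a * x ∈ Submodule.span k Y) {x : A}
    (hx : x ∈ Submodule.span k X) : a * x ∈ Submodule.span k Y := by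
  simpa using Submodule.mul_mem_span_of_forall (b := 1) (fun x hx => by simpa using h x hx) hx

namespace LeavittFamily

variable {K s r} {A : Type} [Ring A] [Algebra K A] (F : LeavittFamily K s r A)

/-- The element of `A` represented by the path with edges `es` starting at `v`. -/
def path : V → List E → A
  | v, [] => F.vert v
  | _, e :: es => F.edge e * path (r e) es

/-- The element of `A` represented by the ghost of the path with edges `es` starting at `v`. -/
def ghostPath : V → List E → A
  | v, [] => F.vert v
  | _, e :: es => ghostPath (r e) es * F.ghost e

@[simp] theorem path_nil (v : V) : F.path v [] = F.vert v := rfl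

@[simp] theorem path_cons (v : V) (e : E) (es : List E) :
    F.path v (e :: es) = F.edge e * F.path (r e) es := rfl

@[simp] theorem ghostPath_nil (v : V) : F.ghostPath v [] = F.vert v := rfl

@[simp] theorem ghostPath_cons (v : V) (e : E) (es : List E) :
    F.ghostPath v (e :: es) = F.ghostPath (r e) es * F.ghost e := rfl

theorem vert_mul_path {v w : V} {es : List E} (h : IsPathFrom s r v w es) :
    F.vert v * F.path v es = F.path v es := by
  cases h with
  | nil => exact F.vert_mul_self v
  | cons e _ => rw [path_cons, ← mul_assoc, F.vert_mul_edge]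

theorem path_mul_vert {v w : V} {es : List E} (h : IsPathFrom s r v w es) :
    F.path v es * F.vert w = F.path v es := by
  induction h with
  | nil => exact F.vert_mul_self _
  | cons e _ ih => rw [path_cons, mul_assoc, ih]

theorem vert_mul_path_ne {u v w : V} {es : List E} (h : IsPathFrom s r v w es) (huv : u ≠ v) :
    F.vert u * F.path v es = 0 := by
  rw [← F.vert_mul_path h, ← mul_assoc, F.vert_mul_ne _ _ huv, zero_mul]

theorem path_mul_vert_ne {u v w : V} {es : List E} (h : IsPathFrom s r v w es) (huw : w ≠ u) :
    F.path v es * F.vert u = 0 := by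
  rw [← F.path_mul_vert h, mul_assoc, F.vert_mul_ne _ _ huw, mul_zero]

theorem path_append {u v w : V} {p q : List E} (hp : IsPathFrom s r u v p)
    (hq : IsPathFrom s r v w q) : F.path u (p ++ q) = F.path u p * F.path v q := by
  induction hp with
  | nil => exact (F.vert_mul_path hq).symm
  | cons e _ ih => rw [List.cons_append, path_cons, ih hq, path_cons, mul_assoc]

theorem ghost_mul_path_cons_self {w : V} {e : E} {es : List E} (h : IsPathFrom s r (r e) w es)
    (v : V) : F.ghost e * F.path v (e :: es) = F.path (r e) es := by
  rw [path_cons, ← mul_assoc, F.ghost_mul_self, F.vert_mul_path h]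

theorem ghost_mul_path_cons_ne {e f : E} {es : List E} (hef : e ≠ f) (v : V) :
    F.ghost e * F.path v (f :: es) = 0 := by
  rw [path_cons, ← mul_assoc, F.ghost_mul_ne _ _ hef, zero_mul]

theorem ghostPath_mul_path_self {v w : V} {es : List E} (h : IsPathFrom s r v w es) :
    F.ghostPath v es * F.path v es = F.vert w := by
  induction h with
  | nil => exact F.vert_mul_self _
  | cons e h ih => rw [ghostPath_cons, mul_assoc, F.ghost_mul_path_cons_self h, ih]

theorem ghostPath_mul_path_eq_zero {v w w' : V} {p q : List E} (hp : IsPathFrom s r v w p)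
    (hq : IsPathFrom s r v w' q) (hlen : p.length ≤ q.length) (hpq : ¬ p <+: q) :
    F.ghostPath v p * F.path v q = 0 := by
  induction p generalizing v q with
  | nil => simp at hpq
  | cons e p ih =>
    cases q with
    | nil => simp at hlen
    | cons f q =>
      rw [isPathFrom_cons_iff] at hp hq
      rw [ghostPath_cons, mul_assoc]
      by_cases hef : e = f
      · subst hef
        rw [F.ghost_mul_path_cons_self hq.2]
        exact ih hp.2 hq.2 (by simpa using hlen) (by simpa using hpq)
      · rw [F.ghost_mul_path_cons_ne hef, mul_zero]

/-- The vertices of an ideal. -/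
def vertexSet (J : TwoSidedIdeal A) : Set V := {v | F.vert v ∈ J}

theorem hereditary_vertexSet (J : TwoSidedIdeal A) : Hereditary s r (F.vertexSet J) := by
  rintro v hv w ⟨es, hes⟩
  change F.vert w ∈ J
  rw [← F.ghostPath_mul_path_self hes, ← F.vert_mul_path hes]
  exact J.mul_mem_left _ _ (J.mul_mem_right _ _ hv)

theorem saturated_vertexSet (J : TwoSidedIdeal A) : Saturated s r (F.vertexSet J) := by
  intro v hfin hne h
  change F.vert v ∈ J
  rw [F.vert_eq_sum v hfin hne]
  refine sum_mem fun e he => ?_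
  rw [← F.edge_mul_vert, mul_assoc]
  exact J.mul_mem_left _ _ (J.mul_mem_right _ _ (h e (by simpa using he)))

theorem exists_ghost_mul_not_mem (hrow : ∀ v : V, {e : E | s e = v}.Finite) {J : TwoSidedIdeal A}
    {v : V} (hv : {e | s e = v}.Nonempty) {b : A} (hb : F.vert v * b = b) (hbJ : b ∉ J) :
    ∃ e, s e = v ∧ F.ghost e * b ∉ J := by
  by_contra! h
  refine hbJ ?_
  rw [← hb, F.vert_eq_sum v (hrow v) hv, Finset.sum_mul]
  refine sum_mem fun e he => ?_
  rw [mul_assoc]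
  exact J.mul_mem_left _ _ (h e (by simpa using he))

theorem exists_mul_edge_not_mem (hrow : ∀ v : V, {e : E | s e = v}.Finite) {J : TwoSidedIdeal A}
    {v : V} (hv : {e | s e = v}.Nonempty) {b : A} (hb : b * F.vert v = b) (hbJ : b ∉ J) :
    ∃ e, s e = v ∧ b * F.edge e ∉ J := by
  by_contra! h
  refine hbJ ?_
  rw [← hb, F.vert_eq_sum v (hrow v) hv, Finset.mul_sum]
  refine sum_mem fun e he => ?_
  rw [← mul_assoc]
  exact J.mul_mem_right _ _ (h e (by simpa using he))

/-- The paths that have length at least `m` or end at a sink. -/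
def longPaths (m : ℕ) : Set A :=
  {x | ∃ v w es, IsPathFrom s r v w es ∧ (m ≤ es.length ∨ ∀ e, s e ≠ w) ∧ x = F.path v es}

theorem longPaths_anti {m n : ℕ} (h : m ≤ n) : F.longPaths n ⊆ F.longPaths m := by
  rintro _ ⟨v, w, es, hes, hl, rfl⟩
  exact ⟨v, w, es, hes, hl.imp_left h.trans, rfl⟩

theorem exists_mul_longPaths_mem_span (a : A) : ∀ m : ℕ, ∃ n : ℕ, ∀ x ∈ F.longPaths n,
    a * x ∈ Submodule.span K (F.longPaths m) := by
  refine F.induction (fun a => ∀ m : ℕ, ∃ n : ℕ, ∀ x ∈ F.longPaths n,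
    a * x ∈ Submodule.span K (F.longPaths m)) ?_ ?_ ?_ ?_ ?_ ?_ a
  · intro k m
    refine ⟨m, fun x hx => ?_⟩
    rw [← Algebra.smul_def]
    exact Submodule.smul_mem _ _ (Submodule.subset_span hx)
  · intro u m
    refine ⟨m, ?_⟩
    rintro _ ⟨v, w, es, hes, hl, rfl⟩
    by_cases huv : u = v
    · subst huv
      rw [F.vert_mul_path hes]
      exact Submodule.subset_span ⟨u, w, es, hes, hl, rfl⟩
    · rw [F.vert_mul_path_ne hes huv]
      exact zero_mem _
  · intro e m
    refine ⟨m, ?_⟩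
    rintro _ ⟨v, w, es, hes, hl, rfl⟩
    by_cases hv : r e = v
    · subst hv
      refine Submodule.subset_span ⟨s e, w, e :: es, .cons e hes, hl.imp_left fun h => ?_, rfl⟩
      rw [List.length_cons]
      exact h.trans (Nat.le_succ _)
    · rw [← F.edge_mul_vert, mul_assoc, F.vert_mul_path_ne hes hv, mul_zero]
      exact zero_mem _
  · intro e m
    refine ⟨m + 1, ?_⟩
    rintro _ ⟨v, w, es, hes, hl, rfl⟩
    cases es with
    | nil =>
      obtain rfl := isPathFrom_nil_iff.1 hes
      have hv : s e ≠ v := (hl.resolve_left (by simp)) e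
      rw [← F.ghost_mul_vert, mul_assoc, F.vert_mul_path_ne hes hv, mul_zero]
      exact zero_mem _
    | cons f es =>
      rw [isPathFrom_cons_iff] at hes
      by_cases hef : e = f
      · subst hef
        rw [F.ghost_mul_path_cons_self hes.2]
        exact Submodule.subset_span ⟨r e, w, es, hes.2, hl.imp_left (by simp), rfl⟩
      · rw [F.ghost_mul_path_cons_ne hef]
        exact zero_mem _
  · intro a b ha hb m
    obtain ⟨n₁, h₁⟩ := ha m
    obtain ⟨n₂, h₂⟩ := hb m
    refine ⟨max n₁ n₂, fun x hx => ?_⟩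
    rw [add_mul]
    exact add_mem (h₁ x (F.longPaths_anti (le_max_left _ _) hx))
      (h₂ x (F.longPaths_anti (le_max_right _ _) hx))
  · intro a b ha hb m
    obtain ⟨n₁, h₁⟩ := ha m
    obtain ⟨n₂, h₂⟩ := hb n₁
    refine ⟨n₂, fun x hx => ?_⟩
    rw [mul_assoc]
    exact Submodule.mul_left_mem_span_of_forall h₁ (h₂ x hx)

theorem exists_mul_longPath_not_mem (hrow : ∀ v : V, {e : E | s e = v}.Finite)
    {J : TwoSidedIdeal A} {v : V} {a : A} (ha : a * F.vert v ∉ J) (n : ℕ) :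
    ∃ w es, IsPathFrom s r v w es ∧ (n ≤ es.length ∨ ∀ e, s e ≠ w) ∧ a * F.path v es ∉ J := by
  induction n with
  | zero => exact ⟨v, [], .nil v, Or.inl (Nat.zero_le _), ha⟩
  | succ n ih =>
    obtain ⟨w, es, hes, hl, hJ⟩ := ih
    by_cases hw : ∀ e, s e ≠ w
    · exact ⟨w, es, hes, Or.inr hw, hJ⟩
    · have hne : {e | s e = w}.Nonempty := by simpa [Set.Nonempty] using hw
      obtain ⟨e, rfl, he⟩ := F.exists_mul_edge_not_mem hrow hne
        (by rw [mul_assoc, F.path_mul_vert hes]) hJ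
      refine ⟨r e, es ++ [e], isPathFrom_append_iff.2 ⟨_, hes, .cons e (.nil _)⟩, Or.inl ?_, ?_⟩
      · simpa using hl.resolve_right hw
      · rw [F.path_append hes (.cons e (.nil _)), path_cons, path_nil, F.edge_mul_vert, ← mul_assoc]
        exact he

/-- The paths from `v` to `w` of length at most `n`. -/
def shortPaths (n : ℕ) (v w : V) : Set A :=
  {x | ∃ es, IsPathFrom s r v w es ∧ es.length ≤ n ∧ x = F.path v es}

theorem shortPaths_mono {m n : ℕ} (h : m ≤ n) (v w : V) :
    F.shortPaths m v w ⊆ F.shortPaths n v w := by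
  rintro _ ⟨es, hes, hl, rfl⟩
  exact ⟨es, hes, hl.trans h, rfl⟩

/-- The paths from `v` to `w` of positive length at most `n`. -/
def shortPosPaths (n : ℕ) (v w : V) : Set A :=
  {x | ∃ es, es ≠ [] ∧ IsPathFrom s r v w es ∧ es.length ≤ n ∧ x = F.path v es}

/-- The closed paths of positive length based at `v`. -/
def closedPaths (v : V) : Set A :=
  {x | ∃ es, es ≠ [] ∧ IsPathFrom s r v v es ∧ x = F.path v es}

theorem exists_corner_mem_span_shortPaths (u w : V) {x : A}
    (hx : x ∈ Submodule.span K (F.longPaths 0)) :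
    ∃ n, F.vert u * x * F.vert w ∈ Submodule.span K (F.shortPaths n u w) := by
  induction hx using Submodule.span_induction with
  | mem x hx =>
    obtain ⟨v, w', es, hes, -, rfl⟩ := hx
    refine ⟨es.length, ?_⟩
    by_cases huv : u = v
    · subst huv
      rw [F.vert_mul_path hes]
      by_cases hw : w' = w
      · subst hw
        rw [F.path_mul_vert hes]
        exact Submodule.subset_span ⟨es, hes, le_rfl, rfl⟩
      · rw [F.path_mul_vert_ne hes hw]
        exact zero_mem _
    · rw [F.vert_mul_path_ne hes huv, zero_mul]
      exact zero_mem _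
  | zero => exact ⟨0, by simp⟩
  | add x y _ _ hx hy =>
    obtain ⟨n₁, h₁⟩ := hx
    obtain ⟨n₂, h₂⟩ := hy
    refine ⟨max n₁ n₂, ?_⟩
    rw [mul_add, add_mul]
    exact add_mem (Submodule.span_mono (F.shortPaths_mono (le_max_left _ _) u w) h₁)
      (Submodule.span_mono (F.shortPaths_mono (le_max_right _ _) u w) h₂)
  | smul c x _ hx =>
    obtain ⟨n, h⟩ := hx
    refine ⟨n, ?_⟩
    rw [mul_smul_comm, smul_mul_assoc]
    exact Submodule.smul_mem _ c h

theorem exists_eq_smul_vert_add {n : ℕ} {u w : V} {b : A}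
    (hb : b ∈ Submodule.span K (F.shortPaths n u w)) :
    ∃ (k : K) (x : A), b = k • F.vert u + x ∧ (k ≠ 0 → u = w) ∧
      x ∈ Submodule.span K (F.shortPosPaths n u w) := by
  induction hb using Submodule.span_induction with
  | mem x hx =>
    obtain ⟨es, hes, hl, rfl⟩ := hx
    by_cases h : es = []
    · subst h
      exact ⟨1, 0, by simp, fun _ => isPathFrom_nil_iff.1 hes, zero_mem _⟩
    · exact ⟨0, _, by rw [zero_smul, zero_add], by simp,
        Submodule.subset_span ⟨es, h, hes, hl, rfl⟩⟩
  | zero => exact ⟨0, 0, by simp, by simp, zero_mem _⟩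
  | add x y _ _ hx hy =>
    obtain ⟨k, x', rfl, hk, hx'⟩ := hx
    obtain ⟨l, y', rfl, hl, hy'⟩ := hy
    refine ⟨k + l, x' + y', by rw [add_smul]; abel, fun h => ?_, add_mem hx' hy'⟩
    by_cases hk0 : k = 0
    · exact hl (by simpa [hk0] using h)
    · exact hk hk0
  | smul c x _ hx =>
    obtain ⟨k, x', rfl, hk, hx'⟩ := hx
    exact ⟨c * k, c • x', by rw [smul_add, smul_smul], fun h => hk (right_ne_zero_of_mul h),
      Submodule.smul_mem _ c hx'⟩

theorem exists_smul_vert_add_mem_diff (hrow : ∀ v : V, {e : E | s e = v}.Finite)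
    {J₁ J₂ : TwoSidedIdeal A} (w : V) (n : ℕ) :
    ∀ (u : V) (b : A), b ∈ Submodule.span K (F.shortPaths n u w) → b ∈ J₂ → b ∉ J₁ →
      ∃ (k : K) (x : A), k ≠ 0 ∧ x ∈ Submodule.span K (F.closedPaths w) ∧
        k • F.vert w + x ∈ J₂ ∧ k • F.vert w + x ∉ J₁ := by
  induction n with
  | zero =>
    intro u b hb h₂ h₁
    obtain ⟨k, x, rfl, hk, hx⟩ := F.exists_eq_smul_vert_add hb
    have hx0 : x = 0 := by
      have : F.shortPosPaths 0 u w = ∅ := by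
        ext y
        simp only [shortPosPaths, Set.mem_ofPred_eq, Set.mem_empty_iff_false, iff_false]
        rintro ⟨es, h, -, hl, -⟩
        exact h (List.length_eq_zero_iff.1 (by omega))
      simpa [this] using hx
    subst hx0
    have hk0 : k ≠ 0 := fun h => h₁ (by simp [h, J₁.zero_mem])
    obtain rfl := hk hk0
    exact ⟨k, 0, hk0, zero_mem _, h₂, h₁⟩
  | succ n ih =>
    intro u b hb h₂ h₁
    obtain ⟨k, x, rfl, hk, hx⟩ := F.exists_eq_smul_vert_add hb
    by_cases hk0 : k = 0
    · subst hk0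
      rw [zero_smul, zero_add] at h₁ h₂
      by_cases hu : {e | s e = u}.Nonempty
      · have hux : F.vert u * x = x := by
          clear h₁ h₂ hb
          induction hx using Submodule.span_induction with
          | mem x hx =>
            obtain ⟨es, -, hes, -, rfl⟩ := hx
            exact F.vert_mul_path hes
          | zero => simp
          | add x y _ _ hx hy => rw [mul_add, hx, hy]
          | smul c x _ hx => rw [mul_smul_comm, hx]
        obtain ⟨e, rfl, he⟩ := F.exists_ghost_mul_not_mem hrow hu hux h₁
        refine ih (r e) (F.ghost e * x) ?_ (J₂.mul_mem_left _ _ h₂) he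
        refine Submodule.mul_left_mem_span_of_forall ?_ hx
        rintro _ ⟨es, h0, hes, hl, rfl⟩
        cases es with
        | nil => exact absurd rfl h0
        | cons f es =>
          rw [isPathFrom_cons_iff] at hes
          by_cases hef : e = f
          · subst hef
            rw [F.ghost_mul_path_cons_self hes.2]
            exact Submodule.subset_span ⟨es, hes.2, by simpa using hl, rfl⟩
          · rw [F.ghost_mul_path_cons_ne hef]
            exact zero_mem _
      · have : F.shortPosPaths (n + 1) u w = ∅ := by
          ext y
          simp only [shortPosPaths, Set.mem_ofPred_eq, Set.mem_empty_iff_false, iff_false]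
          rintro ⟨es, h0, hes, -, -⟩
          cases es with
          | nil => exact h0 rfl
          | cons f es => exact hu ⟨f, (isPathFrom_cons_iff.1 hes).1⟩
        rw [this, Submodule.span_empty, Submodule.mem_bot] at hx
        exact absurd (hx ▸ J₁.zero_mem) h₁
    · obtain rfl := hk hk0
      refine ⟨k, x, hk0, Submodule.span_mono ?_ hx, h₂, h₁⟩
      rintro _ ⟨es, h0, hes, -, rfl⟩
      exact ⟨es, h0, hes, rfl⟩

/-- If some closed path at `w` has an exit `f`, then multiplying by a suitable path and its ghost
kills any given combination of closed paths at `w`. -/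
theorem exists_ghostPath_mul_mul_path_eq_zero {w : V} {c : List E} (hc : IsPathFrom s r w w c)
    {e f : E} (he : e ∈ c) (hs : s f = s e) (hef : f ≠ e) {x : A}
    (hx : x ∈ Submodule.span K (F.closedPaths w)) :
    ∃ γ, IsPathFrom s r w (r f) γ ∧ F.ghostPath w γ * x * F.path w γ = 0 := by
  obtain ⟨pre, post, rfl⟩ := List.append_of_mem he
  have hpre : IsPathFrom s r w (r f) (pre ++ [f]) := by
    obtain ⟨y, hp, hq⟩ := isPathFrom_append_iff.1 hc
    refine isPathFrom_append_iff.2 ⟨y, hp, isPathFrom_cons_iff.2 ⟨?_, .nil _⟩⟩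
    rw [hs, (isPathFrom_cons_iff.1 hq).1]
  set γ : ℕ → List E := fun m =>
    (List.replicate m (pre ++ e :: post)).flatten ++ (pre ++ [f]) with hγ
  have hγp : ∀ m, IsPathFrom s r w (r f) (γ m) := fun m =>
    isPathFrom_append_iff.2 ⟨w, hc.flatten_replicate m, hpre⟩
  suffices h : ∃ M, ∀ m, M ≤ m → F.ghostPath w (γ m) * x * F.path w (γ m) = 0 by
    obtain ⟨M, hM⟩ := h
    exact ⟨γ M, hγp M, hM M le_rfl⟩
  induction hx using Submodule.span_induction with
  | mem x hx =>
    obtain ⟨α, hα0, hα, rfl⟩ := hx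
    refine ⟨α.length, fun m hm => ?_⟩
    rw [mul_assoc, ← F.path_append hα (hγp m)]
    exact F.ghostPath_mul_path_eq_zero (hγp m) (isPathFrom_append_iff.2 ⟨w, hα, hγp m⟩) (by simp)
      (not_prefix_append_of_exit hef hα0 hm)
  | zero => exact ⟨0, by simp⟩
  | add x y _ _ hx hy =>
    obtain ⟨M₁, h₁⟩ := hx
    obtain ⟨M₂, h₂⟩ := hy
    refine ⟨max M₁ M₂, fun m hm => ?_⟩
    rw [mul_add, add_mul, h₁ m (by omega), h₂ m (by omega), add_zero]
  | smul c x _ hx =>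
    obtain ⟨M, h⟩ := hx
    refine ⟨M, fun m hm => ?_⟩
    rw [mul_smul_comm, smul_mul_assoc, h m hm, smul_zero]

open Polynomial in
/-- Relative to `H`, the corner at a vertex of an exitless cycle consists of polynomials in
that cycle. -/
theorem exists_cycle_generator {H : Set V} (hH : Hereditary s r H) {w : V}
    (hw : w ∈ exitlessVertices s r H) :
    ∃ C : A, ∀ (k : K), ∀ x ∈ Submodule.span K (F.closedPaths w),
      ∃ p : K[X], k • F.vert w + x = F.vert w * aeval C p := by
  obtain ⟨hwH, hne, hex⟩ := hw
  obtain ⟨c, ⟨hc0, hc⟩, hmin⟩ := WellFounded.has_min (measure (List.length (α := E))).wf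
    {es | es ≠ [] ∧ IsPathFrom s r w w es} hne
  have hle : ∀ α, α ≠ [] → IsPathFrom s r w w α → c.length ≤ α.length := fun α h0 hα =>
    not_lt.1 (hmin α ⟨h0, hα⟩)
  have hpath : ∀ (n : ℕ) (α : List E), α.length ≤ n → IsPathFrom s r w w α →
      ∃ p : K[X], F.path w α = F.vert w * aeval (F.path w c) p := by
    intro n
    induction n with
    | zero =>
      intro α hα _
      obtain rfl := List.length_eq_zero_iff.1 (Nat.le_zero.1 hα)
      exact ⟨1, by simp⟩
    | succ n ih =>
      intro α hl hα
      by_cases h0 : α = []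
      · exact ⟨1, by simp [h0]⟩
      · obtain ⟨δ, rfl, hδ⟩ := exists_append_of_exitless hH hwH hc hα (hle α h0 hα) (hex c hc)
        have hcl := List.length_pos_iff.2 hc0
        rw [List.length_append] at hl
        obtain ⟨p, hp⟩ := ih δ (by omega) hδ
        refine ⟨X * p, ?_⟩
        rw [F.path_append hc hδ, hp, map_mul, aeval_X, ← mul_assoc, ← mul_assoc,
          F.path_mul_vert hc, F.vert_mul_path hc]
  refine ⟨F.path w c, fun k x hx => ?_⟩
  obtain ⟨p, hp⟩ : ∃ p : K[X], x = F.vert w * aeval (F.path w c) p := by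
    induction hx using Submodule.span_induction with
    | mem x hx =>
      obtain ⟨α, -, hα, rfl⟩ := hx
      exact hpath _ α le_rfl hα
    | zero => exact ⟨0, by simp⟩
    | add x y _ _ hx hy =>
      obtain ⟨p, rfl⟩ := hx
      obtain ⟨q, rfl⟩ := hy
      exact ⟨p + q, by rw [map_add, mul_add]⟩
    | smul c x _ hx =>
      obtain ⟨p, rfl⟩ := hx
      exact ⟨c • p, by rw [map_smul, mul_smul_comm]⟩
  exact ⟨k • 1 + p, by simp [hp, mul_add]⟩

open Polynomial in
/-- Two nested ideals with the same vertices `H` coincide as soon as they contain the same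
polynomials in the cycles that have no exit relative to `H`. -/
theorem le_of_cycle_polynomials (hrow : ∀ v : V, {e : E | s e = v}.Finite)
    {J₁ J₂ : TwoSidedIdeal A} {H : Set V} (h₁H : F.vertexSet J₁ = H) (h₂H : F.vertexSet J₂ = H)
    (hunit : ∀ a ∈ J₂, ∃ T : Finset V, (∑ v ∈ T, F.vert v) * a = a ∧ a * (∑ v ∈ T, F.vert v) = a)
    {C : V → A} (hC : ∀ w ∈ exitlessVertices s r H, ∀ (k : K),
      ∀ x ∈ Submodule.span K (F.closedPaths w),
        ∃ p : K[X], k • F.vert w + x = F.vert w * aeval (C w) p)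
    (hpoly : ∀ w ∈ exitlessVertices s r H, ∀ p : K[X],
      F.vert w * aeval (C w) p ∈ J₂ → F.vert w * aeval (C w) p ∈ J₁) : J₂ ≤ J₁ := by
  intro a ha₂
  by_contra ha₁
  obtain ⟨v, hv⟩ : ∃ v, a * F.vert v ∉ J₁ := by
    by_contra! h
    obtain ⟨T, -, hT⟩ := hunit a ha₂
    refine ha₁ ?_
    rw [← hT, Finset.mul_sum]
    exact sum_mem fun v _ => h v
  obtain ⟨n, hn⟩ := F.exists_mul_longPaths_mem_span a 0
  obtain ⟨w, es, hes, hl, hb₁⟩ := F.exists_mul_longPath_not_mem hrow hv n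
  have hb := hn _ ⟨v, w, es, hes, hl, rfl⟩
  have hbw : a * F.path v es * F.vert w = a * F.path v es := by
    rw [mul_assoc, F.path_mul_vert hes]
  have hb₂ : a * F.path v es ∈ J₂ := J₂.mul_mem_right _ _ ha₂
  generalize a * F.path v es = b at hb hbw hb₁ hb₂
  obtain ⟨u, hu⟩ : ∃ u, F.vert u * b ∉ J₁ := by
    by_contra! h
    obtain ⟨T, hT, -⟩ := hunit b hb₂
    refine hb₁ ?_
    rw [← hT, Finset.sum_mul]
    exact sum_mem fun v _ => h v
  obtain ⟨m, hm⟩ := F.exists_corner_mem_span_shortPaths u w hb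
  rw [mul_assoc, hbw] at hm
  obtain ⟨k, x, hk, hx, hx₂, hx₁⟩ :=
    F.exists_smul_vert_add_mem_diff hrow w m u _ hm (J₂.mul_mem_left _ _ hb₂) hu
  by_cases hw : w ∈ exitlessVertices s r H
  · obtain ⟨p, hp⟩ := hC w hw k x hx
    rw [hp] at hx₁ hx₂
    exact hx₁ (hpoly w hw p hx₂)
  have hwx : F.vert w * x = x := by
    clear hx₁ hx₂
    induction hx using Submodule.span_induction with
    | mem x hx =>
      obtain ⟨es, -, hes, rfl⟩ := hx
      exact F.vert_mul_path hes
    | zero => simp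
    | add x y _ _ hx hy => rw [mul_add, hx, hy]
    | smul c x _ hx => rw [mul_smul_comm, hx]
  have hwH : w ∉ H := by
    intro h
    rw [← h₁H] at h
    refine hx₁ (add_mem (J₁.smul_mem_of_algebra k h) ?_)
    rw [← hwx]
    exact J₁.mul_mem_right _ _ h
  by_cases hcl : ∃ es, es ≠ [] ∧ IsPathFrom s r w w es
  · have hexit : ∃ es, IsPathFrom s r w w es ∧ ∃ e ∈ es, ∃ f, s f = s e ∧ r f ∉ H ∧ f ≠ e := by
      by_contra! h
      exact hw ⟨hwH, hcl, h⟩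
    obtain ⟨c, hc, e, he, f, hs, hf, hef⟩ := hexit
    obtain ⟨γ, hγ, hγx⟩ := F.exists_ghostPath_mul_mul_path_eq_zero hc he hs hef hx
    have h := J₂.mul_mem_right _ (F.path w γ) (J₂.mul_mem_left (F.ghostPath w γ) _ hx₂)
    rw [mul_add, add_mul, hγx, add_zero, mul_smul_comm, smul_mul_assoc, mul_assoc,
      F.vert_mul_path hγ, F.ghostPath_mul_path_self hγ] at h
    rw [← h₂H] at hf
    exact hf (J₂.mem_of_smul_mem hk h)
  · have : F.closedPaths w = ∅ := by
      ext y
      simp only [closedPaths, Set.mem_ofPred_eq, Set.mem_empty_iff_false, iff_false]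
      rintro ⟨es, h0, hes, -⟩
      exact hcl ⟨es, h0, hes⟩
    rw [this, Submodule.span_empty, Submodule.mem_bot] at hx
    rw [hx, add_zero] at hx₂
    rw [← h₂H] at hwH
    exact hwH (J₂.mem_of_smul_mem hk hx₂)

open Polynomial in
/-- The ascending chain condition for hereditary saturated sets implies the one for ideals with
local units. -/
theorem exists_stable_of_acc (hrow : ∀ v : V, {e : E | s e = v}.Finite)
    (hacc : ∀ g : ℕ → Set V, (∀ n, Hereditary s r (g n) ∧ Saturated s r (g n)) → Monotone g →
      ∃ n, ∀ m, n ≤ m → g m = g n) (J : ℕ → TwoSidedIdeal A) (hJ : Monotone J)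
    (hunit : ∀ n, ∀ a ∈ J n, ∃ T : Finset V,
      (∑ v ∈ T, F.vert v) * a = a ∧ a * (∑ v ∈ T, F.vert v) = a) :
    ∃ n, ∀ m, n ≤ m → J m = J n := by
  obtain ⟨N, hN⟩ := hacc (fun n => F.vertexSet (J n))
    (fun n => ⟨F.hereditary_vertexSet _, F.saturated_vertexSet _⟩) fun n m h v hv => hJ h hv
  set H := F.vertexSet (J N) with hHdef
  have hH : Hereditary s r H := F.hereditary_vertexSet _
  have hC : ∀ w, ∃ C : A, w ∈ exitlessVertices s r H → ∀ (k : K),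
      ∀ x ∈ Submodule.span K (F.closedPaths w),
        ∃ p : K[X], k • F.vert w + x = F.vert w * aeval C p := by
    intro w
    by_cases hw : w ∈ exitlessVertices s r H
    · obtain ⟨C, hC⟩ := F.exists_cycle_generator hH hw
      exact ⟨C, fun _ => hC⟩
    · exact ⟨0, fun h => absurd h hw⟩
  choose C hC using hC
  let I : V → ℕ →o Ideal K[X] := fun w =>
    { toFun := fun n =>
        { carrier := {p | F.vert w * aeval (C w) p ∈ J n}
          add_mem' := fun {p q} hp hq => by
            simp only [Set.mem_ofPred_eq, map_add, mul_add] at *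
            exact add_mem hp hq
          zero_mem' := by simp [(J n).zero_mem]
          smul_mem' := fun q p hp => by
            simp only [Set.mem_ofPred_eq, smul_eq_mul, mul_comm q p, map_mul, ← mul_assoc] at *
            exact (J n).mul_mem_right _ _ hp }
      monotone' := fun n m h p hp => hJ h hp }
  have hI : ∀ w, ∃ n, ∀ m, n ≤ m → I w n = I w m := fun w =>
    monotone_stabilizes_iff_noetherian.2 inferInstance (I w)
  choose d hd using hI
  obtain ⟨D, hD⟩ := ((finite_exitlessVertices hH hacc).image d).bddAbove
  refine ⟨max N D, fun m hm => le_antisymm ?_ (hJ hm)⟩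
  refine F.le_of_cycle_polynomials hrow (hN _ (le_max_left _ _)) (hN _ ((le_max_left _ _).trans hm))
    (hunit m) hC fun w hw p hp => ?_
  have hdw : d w ≤ max N D := (hD (Set.mem_image_of_mem d hw)).trans (le_max_right _ _)
  have hp' : p ∈ I w m := hp
  rw [← hd w m (hdw.trans hm), hd w _ hdw] at hp'
  exact hp'

end LeavittFamily

end Family

section Concrete

/-- The generators of the Leavitt path algebra form a Leavitt family. -/
def lpaFamily : LeavittFamily K s r (LPAU K s r) where
  vert := vertexEl K s r
  edge := edgeEl K s r
  ghost := ghostEl K s r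
  vert_mul_self v := by
    simpa [vertexEl, gen] using
      RingQuot.mkAlgHom_rel K (LPARel.vertex_self (K := K) (s := s) (r := r) v)
  vert_mul_ne v w h := by
    simpa [vertexEl, gen] using
      RingQuot.mkAlgHom_rel K (LPARel.vertex_ne (K := K) (s := s) (r := r) h)
  vert_mul_edge e := by
    simpa [vertexEl, edgeEl, gen] using
      RingQuot.mkAlgHom_rel K (LPARel.edge_left (K := K) (s := s) (r := r) e)
  edge_mul_vert e := by
    simpa [vertexEl, edgeEl, gen] using
      RingQuot.mkAlgHom_rel K (LPARel.edge_right (K := K) (s := s) (r := r) e)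
  vert_mul_ghost e := by
    simpa [vertexEl, ghostEl, gen] using
      RingQuot.mkAlgHom_rel K (LPARel.ghost_left (K := K) (s := s) (r := r) e)
  ghost_mul_vert e := by
    simpa [vertexEl, ghostEl, gen] using
      RingQuot.mkAlgHom_rel K (LPARel.ghost_right (K := K) (s := s) (r := r) e)
  ghost_mul_self e := by
    simpa [vertexEl, edgeEl, ghostEl, gen] using
      RingQuot.mkAlgHom_rel K (LPARel.ck1_self (K := K) (s := s) (r := r) e)
  ghost_mul_ne e f h := by
    simpa [edgeEl, ghostEl, gen] using
      RingQuot.mkAlgHom_rel K (LPARel.ck1_ne (K := K) (s := s) (r := r) h)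
  vert_eq_sum v h hne := by
    simpa [vertexEl, edgeEl, ghostEl, gen] using
      RingQuot.mkAlgHom_rel K (LPARel.ck2 (K := K) (s := s) (r := r) v h hne)
  induction p hk hv he hg hadd hmul a := by
    obtain ⟨x, rfl⟩ := RingQuot.mkAlgHom_surjective K (LPARel K s r) a
    induction x using FreeAlgebra.induction with
    | grade0 k => rw [AlgHom.commutes]; exact hk k
    | grade1 g =>
      cases g with
      | vertex v => exact hv v
      | edge e => exact he e
      | ghost e => exact hg e
    | mul a b ha hb => rw [map_mul]; exact hmul _ _ ha hb
    | add a b ha hb => rw [map_add]; exact hadd _ _ ha hb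

variable {K s r}

theorem gen_mem_lpa (g : LPAGen V E) : gen K s r g ∈ lpa K s r :=
  NonUnitalAlgebra.subset_adjoin K (Set.mem_range_self _)

theorem exists_vertex_mul_gen (g : LPAGen V E) :
    ∃ v w, vertexEl K s r v * gen K s r g = gen K s r g ∧
      gen K s r g * vertexEl K s r w = gen K s r g := by
  cases g with
  | vertex v => exact ⟨v, v, (lpaFamily K s r).vert_mul_self v, (lpaFamily K s r).vert_mul_self v⟩
  | edge e =>
    exact ⟨s e, r e, (lpaFamily K s r).vert_mul_edge e, (lpaFamily K s r).edge_mul_vert e⟩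
  | ghost e =>
    exact ⟨r e, s e, (lpaFamily K s r).vert_mul_ghost e, (lpaFamily K s r).ghost_mul_vert e⟩

namespace LeavittFamily

variable {A : Type} [Ring A] [Algebra K A] (F : LeavittFamily K s r A)

theorem sum_vert_mul_vert {T : Finset V} {v : V} (hv : v ∈ T) :
    (∑ u ∈ T, F.vert u) * F.vert v = F.vert v := by
  rw [Finset.sum_mul, Finset.sum_eq_single_of_mem v hv fun u _ huv => F.vert_mul_ne _ _ huv,
    F.vert_mul_self]

theorem vert_mul_sum_vert {T : Finset V} {v : V} (hv : v ∈ T) :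
    F.vert v * (∑ u ∈ T, F.vert u) = F.vert v := by
  rw [Finset.mul_sum, Finset.sum_eq_single_of_mem v hv fun u _ huv => F.vert_mul_ne _ _ huv.symm,
    F.vert_mul_self]

end LeavittFamily

theorem exists_local_unit {a : LPAU K s r} (ha : a ∈ lpa K s r) :
    ∃ T : Finset V, ∀ T', T ⊆ T' → (∑ v ∈ T', vertexEl K s r v) * a = a ∧
      a * (∑ v ∈ T', vertexEl K s r v) = a := by
  classical
  induction ha using NonUnitalAlgebra.adjoin_induction with
  | mem x hx =>
    obtain ⟨g, rfl⟩ := hx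
    obtain ⟨v, w, hv, hw⟩ := exists_vertex_mul_gen (K := K) (s := s) (r := r) g
    refine ⟨{v, w}, fun T' hT => ⟨?_, ?_⟩⟩
    · rw [← hv, ← mul_assoc]
      congr 1
      exact (lpaFamily K s r).sum_vert_mul_vert (hT (by simp))
    · rw [← hw, mul_assoc]
      congr 1
      exact (lpaFamily K s r).vert_mul_sum_vert (hT (by simp))
  | add x y _ _ hx hy =>
    obtain ⟨T₁, h₁⟩ := hx
    obtain ⟨T₂, h₂⟩ := hy
    refine ⟨T₁ ∪ T₂, fun T' hT => ?_⟩
    have h₁ := h₁ T' (Finset.union_subset_left hT)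
    have h₂ := h₂ T' (Finset.union_subset_right hT)
    rw [mul_add, add_mul, h₁.1, h₁.2, h₂.1, h₂.2]
    exact ⟨rfl, rfl⟩
  | zero => exact ⟨∅, by simp⟩
  | mul x y _ _ hx hy =>
    obtain ⟨T₁, h₁⟩ := hx
    obtain ⟨T₂, h₂⟩ := hy
    refine ⟨T₁ ∪ T₂, fun T' hT => ?_⟩
    have h₁ := h₁ T' (Finset.union_subset_left hT)
    have h₂ := h₂ T' (Finset.union_subset_right hT)
    rw [← mul_assoc, h₁.1, mul_assoc, h₂.2]
    exact ⟨rfl, rfl⟩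
  | smul k x _ hx =>
    obtain ⟨T, h⟩ := hx
    refine ⟨T, fun T' hT => ?_⟩
    rw [mul_smul_comm, smul_mul_assoc, (h T' hT).1, (h T' hT).2]
    exact ⟨rfl, rfl⟩

theorem sum_vertexEl_mem_lpa (T : Finset V) : ∑ v ∈ T, vertexEl K s r v ∈ lpa K s r :=
  sum_mem fun _ _ => gen_mem_lpa _

/-- A two-sided ideal of the Leavitt path algebra is a two-sided ideal of its unitalization. -/
def extendIdeal (I : Set (lpa K s r)) (hI : IsTwoSidedIdealSet I) : TwoSidedIdeal (LPAU K s r) :=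
  .mk' (Subtype.val '' I) ⟨0, hI.1, rfl⟩
    (by
      rintro _ _ ⟨a, ha, rfl⟩ ⟨b, hb, rfl⟩
      exact ⟨a + b, hI.2.1 a ha b hb, rfl⟩)
    (by
      rintro _ ⟨a, ha, rfl⟩
      exact ⟨-a, hI.2.2.1 a ha, rfl⟩)
    (by
      intro x y hy
      revert y
      refine (lpaFamily K s r).induction
        (fun x => ∀ {y : LPAU K s r}, y ∈ Subtype.val '' I → x * y ∈ Subtype.val '' I)
        ?_ ?_ ?_ ?_ ?_ ?_ x
      · rintro k _ ⟨a, ha, rfl⟩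
        obtain ⟨T, hT⟩ := exists_local_unit a.2
        refine ⟨k • ⟨_, sum_vertexEl_mem_lpa T⟩ * a, (hI.2.2.2 _ a ha).1, ?_⟩
        change (k • ∑ v ∈ T, vertexEl K s r v) * (a : LPAU K s r) = _
        rw [smul_mul_assoc, (hT T subset_rfl).1, Algebra.smul_def]
      · rintro v _ ⟨a, ha, rfl⟩
        exact ⟨⟨_, gen_mem_lpa _⟩ * a, (hI.2.2.2 _ a ha).1, rfl⟩
      · rintro v _ ⟨a, ha, rfl⟩
        exact ⟨⟨_, gen_mem_lpa _⟩ * a, (hI.2.2.2 _ a ha).1, rfl⟩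
      · rintro v _ ⟨a, ha, rfl⟩
        exact ⟨⟨_, gen_mem_lpa _⟩ * a, (hI.2.2.2 _ a ha).1, rfl⟩
      · rintro x y hx hy _ ⟨a, ha, rfl⟩
        rw [add_mul]
        obtain ⟨b, hb, hb'⟩ := hx ⟨a, ha, rfl⟩
        obtain ⟨c, hc, hc'⟩ := hy ⟨a, ha, rfl⟩
        rw [← hb', ← hc']
        exact ⟨b + c, hI.2.1 b hb c hc, rfl⟩
      · rintro x y hx hy z hz
        rw [mul_assoc]
        exact hx (hy hz))
    (by
      intro y x hy
      revert y
      refine (lpaFamily K s r).induction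
        (fun x => ∀ {y : LPAU K s r}, y ∈ Subtype.val '' I → y * x ∈ Subtype.val '' I)
        ?_ ?_ ?_ ?_ ?_ ?_ x
      · rintro k _ ⟨a, ha, rfl⟩
        obtain ⟨T, hT⟩ := exists_local_unit a.2
        refine ⟨a * k • ⟨_, sum_vertexEl_mem_lpa T⟩, (hI.2.2.2 _ a ha).2, ?_⟩
        change (a : LPAU K s r) * (k • ∑ v ∈ T, vertexEl K s r v) = _
        rw [mul_smul_comm, (hT T subset_rfl).2, Algebra.smul_def, Algebra.commutes]
      · rintro v _ ⟨a, ha, rfl⟩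
        exact ⟨a * ⟨_, gen_mem_lpa _⟩, (hI.2.2.2 _ a ha).2, rfl⟩
      · rintro v _ ⟨a, ha, rfl⟩
        exact ⟨a * ⟨_, gen_mem_lpa _⟩, (hI.2.2.2 _ a ha).2, rfl⟩
      · rintro v _ ⟨a, ha, rfl⟩
        exact ⟨a * ⟨_, gen_mem_lpa _⟩, (hI.2.2.2 _ a ha).2, rfl⟩
      · rintro x y hx hy _ ⟨a, ha, rfl⟩
        rw [mul_add]
        obtain ⟨b, hb, hb'⟩ := hx ⟨a, ha, rfl⟩
        obtain ⟨c, hc, hc'⟩ := hy ⟨a, ha, rfl⟩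
        rw [← hb', ← hc']
        exact ⟨b + c, hI.2.1 b hb c hc, rfl⟩
      · rintro x y hx hy z hz
        rw [← mul_assoc]
        exact hy (hx hz))

theorem mem_extendIdeal {I : Set (lpa K s r)} (hI : IsTwoSidedIdealSet I) (x : LPAU K s r) :
    x ∈ extendIdeal I hI ↔ x ∈ Subtype.val '' I :=
  TwoSidedIdeal.mem_mk' ..

theorem lpa_acc_of_hereditary_saturated_acc (hrow : ∀ v : V, {e : E | s e = v}.Finite)
    (hacc : ∀ g : ℕ → Set V, (∀ n, Hereditary s r (g n) ∧ Saturated s r (g n)) → Monotone g →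
      ∃ n, ∀ m, n ≤ m → g m = g n) (f : ℕ → Set (lpa K s r))
    (hf : ∀ n, IsTwoSidedIdealSet (f n)) (hmono : Monotone f) : ∃ n, ∀ m, n ≤ m → f m = f n := by
  obtain ⟨n, hn⟩ := (lpaFamily K s r).exists_stable_of_acc hrow hacc
    (fun n => extendIdeal (f n) (hf n))
    (fun n m h x hx => by
      rw [mem_extendIdeal] at hx ⊢
      exact Set.image_mono (hmono h) hx)
    (fun n a ha => by
      rw [mem_extendIdeal] at ha
      obtain ⟨a, -, rfl⟩ := ha
      obtain ⟨T, hT⟩ := exists_local_unit a.2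
      exact ⟨T, hT T subset_rfl⟩)
  refine ⟨n, fun m hm => Subtype.val_injective.image_injective ?_⟩
  ext x
  rw [← mem_extendIdeal (hf m), ← mem_extendIdeal (hf n)]
  exact iff_of_eq (congrArg (x ∈ ·) (hn m hm))

section Representation

variable (s r) in
/-- For every vertex with an edge that ends outside `H`, the set `ℕ` splits into copies of itself
indexed by these edges. -/
theorem exists_splitting (hrow : ∀ v : V, {e : E | s e = v}.Finite) (H : Set V) :
    ∃ φ : E → ℕ → ℕ, (∀ e, r e ∉ H → (φ e).Injective) ∧
      (∀ e f, r e ∉ H → r f ∉ H → s e = s f → e ≠ f → ∀ m n, φ e m ≠ φ f n) ∧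
      ∀ v, (∃ e, s e = v ∧ r e ∉ H) → ∀ n, ∃ e m, s e = v ∧ r e ∉ H ∧ φ e m = n := by
  classical
  have h : ∀ v, Nonempty {e // s e = v ∧ r e ∉ H} →
      Nonempty ({e // s e = v ∧ r e ∉ H} × ℕ ≃ ℕ) := fun v hv => by
    have : Finite {e // s e = v ∧ r e ∉ H} := ((hrow v).subset fun e he => he.1).to_subtype
    exact nonempty_equiv_of_countable
  let ψ (v : V) (hv : Nonempty {e // s e = v ∧ r e ∉ H}) := (h v hv).some
  let φ : E → ℕ → ℕ := fun e m =>
    if he : r e ∉ H then ψ (s e) ⟨e, rfl, he⟩ (⟨e, rfl, he⟩, m) else 0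
  have hφ : ∀ (v : V) (hv) (e : E) (hs : s e = v) (he : r e ∉ H) m,
      φ e m = ψ v hv (⟨e, hs, he⟩, m) := by
    rintro v hv e rfl he m
    exact dif_pos he
  refine ⟨φ, fun e he m n hmn => ?_, fun e f he hf hs hef m n hmn => ?_, fun v hv n => ?_⟩
  · rw [hφ (s e) ⟨e, rfl, he⟩ e rfl he, hφ (s e) ⟨e, rfl, he⟩ e rfl he] at hmn
    simpa using hmn
  · rw [hφ (s e) ⟨e, rfl, he⟩ e rfl he, hφ (s e) ⟨e, rfl, he⟩ f hs.symm hf] at hmn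
    have := (ψ (s e) ⟨e, rfl, he⟩).injective hmn
    simp only [Prod.mk.injEq, Subtype.mk.injEq] at this
    exact hef this.1
  · have hv' : Nonempty {e // s e = v ∧ r e ∉ H} := let ⟨e, he⟩ := hv; ⟨e, he⟩
    refine ⟨((ψ v hv').symm n).1, ((ψ v hv').symm n).2, ((ψ v hv').symm n).1.2.1,
      ((ψ v hv').symm n).1.2.2, ?_⟩
    rw [hφ v hv' _ ((ψ v hv').symm n).1.2.1 ((ψ v hv').symm n).1.2.2]
    exact (ψ v hv').apply_symm_apply n

open Classical in
/-- The matrix unit `(u, w)` with entry `T`, acting on `V`-indexed families. -/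
noncomputable def matrixUnit {M : Type} [AddCommGroup M] [Module K M] (u w : V) :
    Module.End K M →ₗ[K] Module.End K (V → M) where
  toFun T := LinearMap.single K (fun _ => M) u ∘ₗ T ∘ₗ LinearMap.proj w
  map_add' T S := by ext; simp [Pi.single_add]
  map_smul' c T := by ext; simp [Pi.single_smul]

section MatrixUnit

variable {M : Type} [AddCommGroup M] [Module K M]

theorem matrixUnit_mul (u w x : V) (T S : Module.End K M) :
    matrixUnit u w T * matrixUnit w x S = matrixUnit u x (T * S) := by
  apply LinearMap.ext
  intro f
  simp [matrixUnit]

theorem matrixUnit_mul_ne (u x : V) {w w' : V} (h : w ≠ w') (T S : Module.End K M) :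
    matrixUnit u w T * matrixUnit w' x S = 0 := by
  apply LinearMap.ext
  intro f
  simp [matrixUnit, h]

theorem matrixUnit_ne_zero (u : V) [Nontrivial M] :
    matrixUnit u u (1 : Module.End K M) ≠ 0 := by
  intro h
  obtain ⟨m, hm⟩ := exists_ne (0 : M)
  refine hm ?_
  simpa [matrixUnit] using congrFun (LinearMap.congr_fun h fun _ => m) u

end MatrixUnit

variable (K) in
/-- Modulo the ideal generated by a hereditary saturated set `H`, the vertices outside `H` do not
vanish. -/
theorem exists_representation (hrow : ∀ v : V, {e : E | s e = v}.Finite) {H : Set V}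
    (hH : Hereditary s r H) (hsat : Saturated s r H) :
    ∃ Φ : LPAU K s r →ₐ[K] Module.End K (V → ℕ → K), ∀ v, Φ (vertexEl K s r v) = 0 ↔ v ∈ H := by
  classical
  obtain ⟨φ, hinj, hdisj, hcover⟩ := exists_splitting s r hrow H
  let P : V → Module.End K (ℕ → K) := fun v => if v ∈ H then 0 else 1
  let X : E → Module.End K (ℕ → K) := fun e =>
    if r e ∈ H then 0 else Function.ExtendByZero.linearMap K (φ e)
  let Y : E → Module.End K (ℕ → K) := fun e =>
    if r e ∈ H then 0 else LinearMap.funLeft K K (φ e)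
  have hsr : ∀ e, s e ∈ H → r e ∈ H := fun e he => hH _ he _ (Geq.of_edge e)
  have hPP : ∀ v, P v * P v = P v := fun v => by by_cases h : v ∈ H <;> simp [P, h]
  have hPX : ∀ e, P (s e) * X e = X e := fun e => by
    by_cases h : s e ∈ H <;> simp [P, X, h, hsr]
  have hXP : ∀ e, X e * P (r e) = X e := fun e => by
    by_cases h : r e ∈ H <;> simp [P, X, h]
  have hPY : ∀ e, P (r e) * Y e = Y e := fun e => by
    by_cases h : r e ∈ H <;> simp [P, Y, h]
  have hYP : ∀ e, Y e * P (s e) = Y e := fun e => by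
    by_cases h : s e ∈ H <;> simp [P, Y, h, hsr]
  have hYX : ∀ e, Y e * X e = P (r e) := fun e => by
    by_cases h : r e ∈ H
    · simp [P, X, Y, h]
    · apply LinearMap.ext
      intro g
      funext n
      simp [P, X, Y, h, LinearMap.funLeft_apply, (hinj e h).extend_apply]
  have hYX0 : ∀ e f, s e = s f → e ≠ f → Y e * X f = 0 := fun e f hs hef => by
    by_cases h : r e ∈ H
    · simp [Y, h]
    by_cases h' : r f ∈ H
    · simp [X, h']
    apply LinearMap.ext
    intro g
    funext n
    have : ¬ ∃ m, φ f m = φ e n := fun ⟨m, hm⟩ => hdisj e f h h' hs hef n m hm.symm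
    simp [X, Y, h, h', LinearMap.funLeft_apply, Function.extend_apply' _ _ _ this]
  have hsum : ∀ v (h : {e | s e = v}.Finite), {e | s e = v}.Nonempty →
      P v = ∑ e ∈ h.toFinset, X e * Y e := by
    intro v h hne
    by_cases hv : v ∈ H
    · rw [Finset.sum_eq_zero]
      · simp [P, hv]
      · intro e he
        have : s e = v := by simpa using he
        simp [X, hsr e (this ▸ hv)]
    · apply LinearMap.ext
      intro g
      funext n
      have hgood : ∃ e, s e = v ∧ r e ∉ H := by
        by_contra! hall
        exact hv (hsat v h hne hall)
      obtain ⟨e, m, hs, he, rfl⟩ := hcover v hgood n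
      rw [LinearMap.sum_apply, Finset.sum_apply, Finset.sum_eq_single_of_mem e (by simpa using hs)]
      · simp [P, X, Y, hv, he, LinearMap.funLeft_apply, (hinj e he).extend_apply]
      · intro f hf hfe
        have hf : s f = v := by simpa using hf
        by_cases hrf : r f ∈ H
        · simp [X, hrf]
        · have : ¬ ∃ k, φ f k = φ e m := fun ⟨k, hk⟩ =>
            hdisj f e hrf he (hf.trans hs.symm) hfe k m hk
          simp [X, Y, hrf, Function.extend_apply' _ _ _ this]
  let ρ : LPAGen V E → Module.End K (V → ℕ → K)
    | .vertex v => matrixUnit v v (P v)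
    | .edge e => matrixUnit (s e) (r e) (X e)
    | .ghost e => matrixUnit (r e) (s e) (Y e)
  have hρ : ∀ ⦃x y⦄, LPARel K s r x y → FreeAlgebra.lift K ρ x = FreeAlgebra.lift K ρ y := by
    intro x y hxy
    cases hxy with
    | vertex_self v => simp [ρ, matrixUnit_mul, hPP]
    | vertex_ne h => simp [ρ, matrixUnit_mul_ne _ _ h]
    | edge_left e => simp [ρ, matrixUnit_mul, hPX]
    | edge_right e => simp [ρ, matrixUnit_mul, hXP]
    | ghost_left e => simp [ρ, matrixUnit_mul, hPY]
    | ghost_right e => simp [ρ, matrixUnit_mul, hYP]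
    | ck1_self e => simp [ρ, matrixUnit_mul, hYX]
    | @ck1_ne e f h =>
      by_cases hs : s e = s f
      · simp only [map_mul, FreeAlgebra.lift_ι_apply, map_zero, ρ]
        rw [hs, matrixUnit_mul, hYX0 e f hs h, map_zero]
      · simp [ρ, matrixUnit_mul_ne _ _ hs]
    | ck2 v h hne =>
      simp only [map_sum, map_mul, FreeAlgebra.lift_ι_apply, ρ]
      rw [hsum v h hne, map_sum]
      refine Finset.sum_congr rfl fun e he => ?_
      obtain rfl : s e = v := by simpa using he
      rw [matrixUnit_mul]
  refine ⟨RingQuot.liftAlgHom K ⟨FreeAlgebra.lift K ρ, hρ⟩, fun v => ?_⟩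
  rw [vertexEl, gen, RingQuot.liftAlgHom_mkAlgHom_apply, FreeAlgebra.lift_ι_apply]
  by_cases hv : v ∈ H
  · simp [ρ, P, hv]
  · simp [ρ, P, hv, matrixUnit_ne_zero]

variable (K) in
theorem vertexEl_mem_span_iff (hrow : ∀ v : V, {e : E | s e = v}.Finite) {H : Set V}
    (hH : Hereditary s r H) (hsat : Saturated s r H) (v : V) :
    vertexEl K s r v ∈ TwoSidedIdeal.span (vertexEl K s r '' H) ↔ v ∈ H := by
  refine ⟨fun h => ?_, fun h => TwoSidedIdeal.subset_span (Set.mem_image_of_mem _ h)⟩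
  obtain ⟨Φ, hΦ⟩ := exists_representation K hrow hH hsat
  rw [← hΦ, ← TwoSidedIdeal.mem_ker]
  refine TwoSidedIdeal.span_le.2 ?_ h
  rintro _ ⟨w, hw, rfl⟩
  exact (TwoSidedIdeal.mem_ker _).2 ((hΦ w).2 hw)

end Representation

variable (K) in
theorem hereditary_saturated_acc_of_lpa_acc (hrow : ∀ v : V, {e : E | s e = v}.Finite)
    (hacc : ∀ f : ℕ → Set (lpa K s r), (∀ n, IsTwoSidedIdealSet (f n)) → Monotone f →
      ∃ n, ∀ m, n ≤ m → f m = f n) (g : ℕ → Set V)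
    (hg : ∀ n, Hereditary s r (g n) ∧ Saturated s r (g n)) (hmono : Monotone g) :
    ∃ n, ∀ m, n ≤ m → g m = g n := by
  let I : ℕ → TwoSidedIdeal (LPAU K s r) := fun n => .span (vertexEl K s r '' g n)
  obtain ⟨n, hn⟩ := hacc (fun n => {a | (a : LPAU K s r) ∈ I n})
    (fun n => ⟨(I n).zero_mem, fun a ha b hb => (I n).add_mem ha hb, fun a ha => (I n).neg_mem ha,
      fun x a ha => ⟨(I n).mul_mem_left _ _ ha, (I n).mul_mem_right _ _ ha⟩⟩)
    (fun n m h a ha => TwoSidedIdeal.span_mono (Set.image_mono (hmono h)) ha)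
  refine ⟨n, fun m hm => Set.ext fun v => ?_⟩
  rw [← vertexEl_mem_span_iff K hrow (hg m).1 (hg m).2,
    ← vertexEl_mem_span_iff K hrow (hg n).1 (hg n).2]
  exact Set.ext_iff.1 (hn m hm) (vertexIn K s r v)

end Concrete

/-- For a row-finite graph `E` and any field `K`: the Leavitt path algebra `L_K(E)` has
the ascending chain condition on two-sided ideals if and only if the poset (under
inclusion) of hereditary saturated subsets of `E⁰` has the ascending chain condition.
In particular, for every finite graph `E`, `L_K(E)` has the a.c.c. on two-sided
ideals. -/
theorem acc_two_sided_ideals (K V E : Type) [Field K] (s r : E → V)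
    (hrow : ∀ v : V, {e : E | s e = v}.Finite) :
    ((∀ f : ℕ → Set ↥(lpa K s r), (∀ n, IsTwoSidedIdealSet (f n)) → Monotone f →
        ∃ n, ∀ m, n ≤ m → f m = f n) ↔
      (∀ g : ℕ → Set V, (∀ n, Hereditary s r (g n) ∧ Saturated s r (g n)) → Monotone g →
        ∃ n, ∀ m, n ≤ m → g m = g n)) ∧
    (Finite V → Finite E →
      ∀ f : ℕ → Set ↥(lpa K s r), (∀ n, IsTwoSidedIdealSet (f n)) → Monotone f →
        ∃ n, ∀ m, n ≤ m → f m = f n) := by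
  refine ⟨⟨hereditary_saturated_acc_of_lpa_acc K hrow, lpa_acc_of_hereditary_saturated_acc hrow⟩,
    fun _ _ => lpa_acc_of_hereditary_saturated_acc hrow fun g _ hg => ?_⟩
  obtain ⟨n, hn⟩ := WellFoundedGT.monotone_chain_condition ⟨g, hg⟩
  exact ⟨n, fun m hm => (hn m hm).symm⟩
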